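/- Let K be a field of characteristic zero. The following are equivalent: (1) [Jacobian conjecture] every K-algebra endomorphism f of K[x,y] with Jac(f(x), f(y)) a nonzero element of K is a K-algebra automorphism; (2) [g,h conjecture] for every K-algebra endomorphism f of K[x,y] with Jac(f(x), f(y)) a nonzero element of K, there exist K-algebra automorphisms g and h of K[x,y] such that h∘f∘g⁻¹ commutes with the exchange involution α, i.e., (h∘f∘g⁻¹)∘α = α∘(h∘f∘g⁻¹). -/

import Mathlib

open MvPolynomial

/-- The Jacobian of two polynomials in `K[x,y]` (variables indexed by `Fin 2`). -/
noncomputable def Jac {K : Type*} [CommRing K]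
    (P Q : MvPolynomial (Fin 2) K) : MvPolynomial (Fin 2) K :=
  pderiv 0 P * pderiv 1 Q - pderiv 1 P * pderiv 0 Q

/-- The exchange involution `α` on `K[x,y]`, swapping the two variables. -/
noncomputable def exch (K : Type*) [CommSemiring K] :
    MvPolynomial (Fin 2) K ≃ₐ[K] MvPolynomial (Fin 2) K :=
  MvPolynomial.renameEquiv K (Equiv.swap 0 1)

/-- An involution on a `K`-algebra: an algebra automorphism of order 2. -/
def IsInvolution {K R : Type*} [CommSemiring K] [Semiring R] [Algebra K R]
    (γ : R ≃ₐ[K] R) : Prop :=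
  (∀ p, γ (γ p) = p) ∧ γ ≠ AlgEquiv.refl


/-- Combinatorial core: a Newton-polygon argument. -/
theorem comb_core {ι : Type*} (A B : Finset ι) (a b : ι → ℤ) (ha : ∀ i, 0 ≤ a i)
    (hb : ∀ i, 0 ≤ b i)
    (H : ∀ u ∈ A, ∀ v ∈ B, (∀ u' ∈ A, ∀ v' ∈ B, a u' + a v' = a u + a v →
        b u' + b v' = b u + b v → a u' = a u ∧ b u' = b u) →
        (a u + a v = 1 ∧ b u + b v = 1) ∨ a u * b v = b u * a v)
    (hB : ∀ v ∈ B, 1 ≤ b v)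
    (e : ι) (he : e ∈ A) (he0 : a e = 1) (he1 : b e = 0)
    (e' : ι) (he' : e' ∈ B) (he0' : a e' = 0) (he1' : b e' = 1) :
    (∀ u ∈ A, (a u = 1 ∧ b u = 0) ∨ a u = 0) ∧ (∀ v ∈ B, a v = 0 ∧ b v = 1) := by
  classical
  have step1 : (∀ u ∈ A, b u = 0 → a u ≤ 1) ∧ (∀ v ∈ B, b v = 1 → a v = 0) := by
    obtain ⟨u, hu, humax⟩ := Finset.exists_max_image (A.filter (fun u => b u = 0)) a
      ⟨e, by simp [he, he1]⟩
    obtain ⟨v, hv, hvmax⟩ := Finset.exists_max_image (B.filter (fun u => b u = 1)) a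
      ⟨e', by simp [he', he1']⟩
    simp only [Finset.mem_filter] at hu hv humax hvmax
    have h1 := H u hu.1 v hv.1 (by
      intro u' hu' v' hv' e1 e2
      have := hB v' hv'
      have := hb u'
      have q1 := humax u' ⟨hu', by omega⟩
      have q2 := hvmax v' ⟨hv', by omega⟩
      constructor <;> omega)
    have h2 := humax e ⟨he, he1⟩
    have h3 := ha v
    rw [hu.2, hv.2] at h1
    refine ⟨fun w hw hw0 => ?_, fun w hw hw0 => ?_⟩
    · have := humax w ⟨hw, hw0⟩
      omega
    · have := hvmax w ⟨hw, hw0⟩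
      have := ha w
      omega
  by_contra hcon
  -- bad shifted exponents
  set D : Finset (ℤ × ℤ) :=
    ((A.filter (fun u => 1 ≤ a u ∧ 1 ≤ b u)).image (fun u => (a u - 1, b u))) ∪
    ((B.filter (fun v => 2 ≤ b v)).image (fun v => (a v, b v - 1))) with hD
  have memD : ∀ d, d ∈ D ↔ (∃ u ∈ A, 1 ≤ a u ∧ 1 ≤ b u ∧ d = (a u - 1, b u)) ∨
      (∃ v ∈ B, 2 ≤ b v ∧ d = (a v, b v - 1)) := by
    intro d
    simp only [hD, Finset.mem_union, Finset.mem_image, Finset.mem_filter]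
    constructor
    · rintro (⟨u, ⟨h1, h2, h3⟩, rfl⟩ | ⟨u, ⟨h1, h2⟩, rfl⟩)
      · exact Or.inl ⟨u, h1, h2, h3, rfl⟩
      · exact Or.inr ⟨u, h1, h2, rfl⟩
    · rintro (⟨u, h1, h2, h3, rfl⟩ | ⟨u, h1, h2, rfl⟩)
      · exact Or.inl ⟨u, ⟨h1, h2, h3⟩, rfl⟩
      · exact Or.inr ⟨u, ⟨h1, h2⟩, rfl⟩
  have Dpos : ∀ d ∈ D, 0 ≤ d.1 ∧ 1 ≤ d.2 := by
    intro d hd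
    rcases (memD d).1 hd with ⟨u, _, h2, h3, rfl⟩ | ⟨u, _, h2, rfl⟩
    · simp only; omega
    · have := ha u
      simp only; omega
  have Dne : D.Nonempty := by
    by_contra hne
    rw [Finset.not_nonempty_iff_eq_empty] at hne
    apply hcon
    constructor
    · intro u hu
      by_contra hh
      have h0 := ha u
      have h1 := hb u
      have h2 := step1.1 u hu
      have : (a u - 1, b u) ∈ D := (memD _).2 (Or.inl ⟨u, hu, by omega, by omega, rfl⟩)
      simp [hne] at this
    · intro v hv
      by_contra hh
      have h1 := hB v hv
      have h2 := step1.2 v hv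
      have : (a v, b v - 1) ∈ D := (memD _).2 (Or.inr ⟨v, hv, by omega, rfl⟩)
      simp [hne] at this
  obtain ⟨m, hm, hmmax⟩ := Finset.exists_max_image D (fun d => (d.1 : ℚ) / d.2) Dne
  have hmpos := Dpos m hm
  have slope : ∀ d ∈ D, m.2 * d.1 ≤ m.1 * d.2 := by
    intro d hd
    have h1 := hmmax d hd
    have h2 := Dpos d hd
    have q1 : (0 : ℚ) < d.2 := by exact_mod_cast (by omega : (0 : ℤ) < d.2)
    have q2 : (0 : ℚ) < m.2 := by exact_mod_cast (by omega : (0 : ℤ) < m.2)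
    rw [div_le_div_iff₀ q1 q2] at h1
    have : d.1 * m.2 ≤ m.1 * d.2 := by exact_mod_cast h1
    linarith
  have LA : ∀ u ∈ A, m.2 * (a u - 1) ≤ m.1 * b u := by
    intro u hu
    have h0 := ha u
    have h1 := hb u
    have h2 := step1.1 u hu
    have h3 : 0 ≤ m.1 * b u := mul_nonneg hmpos.1 h1
    by_cases hbad : 1 ≤ a u ∧ 1 ≤ b u
    · exact slope (a u - 1, b u) ((memD _).2 (Or.inl ⟨u, hu, hbad.1, hbad.2, rfl⟩))
    · have : a u - 1 ≤ 0 := by omega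
      nlinarith
  have LB : ∀ v ∈ B, m.2 * a v ≤ m.1 * (b v - 1) := by
    intro v hv
    have h1 := hB v hv
    have h2 := step1.2 v hv
    by_cases hbad : 2 ≤ b v
    · exact slope (a v, b v - 1) ((memD _).2 (Or.inr ⟨v, hv, hbad, rfl⟩))
    · have h3 : b v = 1 := by omega
      rw [h2 h3, h3]; simp
  obtain ⟨u, hu, humax⟩ := Finset.exists_max_image
    (A.filter (fun u => m.2 * (a u - 1) = m.1 * b u)) b ⟨e, by simp [he, he0, he1]⟩
  obtain ⟨v, hv, hvmax⟩ := Finset.exists_max_image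
    (B.filter (fun v => m.2 * a v = m.1 * (b v - 1))) b ⟨e', by simp [he', he0', he1']⟩
  simp only [Finset.mem_filter] at hu hv humax hvmax
  have hbu := hb u
  have hbv := hB v hv.1
  have big : 2 ≤ b u + b v := by
    rcases (memD m).1 hm with ⟨w, hw, h1, h2, h3⟩ | ⟨w, hw, h1, h3⟩
    · have := humax w ⟨hw, by rw [h3]; ring⟩
      omega
    · have := hvmax w ⟨hw, by rw [h3]; ring⟩
      omega
  rcases H u hu.1 v hv.1 (by
      intro u' hu' v' hv' e1 e2
      have l1 := LA u' hu'
      have l2 := LB v' hv'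
      have s : m.2 * (a u' - 1) + m.2 * a v' = m.1 * b u' + m.1 * (b v' - 1) := by
        linear_combination m.2 * e1 - m.1 * e2 + hu.2 + hv.2
      have k1 : m.2 * (a u' - 1) = m.1 * b u' := by linarith
      have k2 : m.2 * a v' = m.1 * (b v' - 1) := by linarith
      have q1 := humax u' ⟨hu', k1⟩
      have q2 := hvmax v' ⟨hv', k2⟩
      have q3 : b u' = b u := by omega
      refine ⟨?_, q3⟩
      have k3 : m.2 * (a u' - a u) = 0 := by rw [q3] at k1; linear_combination k1 - hu.2
      rcases mul_eq_zero.1 k3 with k | k <;> omega) with h | h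
  · omega
  · have : m.2 * b v + m.1 * b u = 0 := by
      linear_combination m.2 * h - b v * hu.2 + b u * hv.2
    nlinarith [mul_nonneg hmpos.1 hbu]

section helpers
variable {K : Type*} [Field K]

theorem coeff_X_mul_pderiv (i : Fin 2) (P : MvPolynomial (Fin 2) K) (s : Fin 2 →₀ ℕ) :
    coeff s (X i * pderiv i P) = (s i : K) * coeff s P := by
  classical
  induction P using MvPolynomial.induction_on' with
  | monomial u c =>
    rw [X_mul_pderiv_monomial, coeff_smul, coeff_monomial]
    split_ifs with h
    · subst h; simp
    · simp
  | add p q hp hq => simp only [map_add, mul_add, coeff_add, hp, hq]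

theorem jac_coeff (P Q : MvPolynomial (Fin 2) K) (n : Fin 2 →₀ ℕ) :
    coeff n (X 0 * X 1 * Jac P Q) = ∑ st ∈ Finset.HasAntidiagonal.antidiagonal n,
      coeff st.1 P * coeff st.2 Q * ((st.1 0 : K) * st.2 1 - st.1 1 * st.2 0) := by
  classical
  have : X 0 * X 1 * Jac P Q = (X 0 * pderiv 0 P) * (X 1 * pderiv 1 Q)
      - (X 1 * pderiv 1 P) * (X 0 * pderiv 0 Q) := by
    unfold Jac; ring
  rw [this, coeff_sub, coeff_mul, coeff_mul, ← Finset.sum_sub_distrib]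
  refine Finset.sum_congr rfl fun st _ => ?_
  simp only [coeff_X_mul_pderiv]
  ring

theorem xy_coeff (c : K) (n : Fin 2 →₀ ℕ) (h : coeff n (X 0 * X 1 * C c) ≠ 0) :
    n 0 = 1 ∧ n 1 = 1 := by
  classical
  have : (X 0 * X 1 * C c : MvPolynomial (Fin 2) K) =
      monomial (Finsupp.single 0 1 + Finsupp.single 1 1) c := by
    rw [X, X, C_apply, monomial_mul, monomial_mul]; simp
  rw [this, coeff_monomial] at h
  split_ifs at h with h'
  · subst h'; simp
  · simp at h

theorem fin2_ext {s t : Fin 2 →₀ ℕ} (h0 : s 0 = t 0) (h1 : s 1 = t 1) : s = t := by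
  ext i; fin_cases i <;> assumption

/-- A normalised Jacobian pair is triangular. -/
theorem triangular [CharZero K] (P Q : MvPolynomial (Fin 2) K) (c : K) (hc : c ≠ 0)
    (hJ : Jac P Q = C c) (hP0 : coeff 0 P = 0)
    (hQ : ∀ s : Fin 2 →₀ ℕ, s 1 = 0 → coeff s Q = 0) :
    (∀ s ∈ P.support, (s 0 = 1 ∧ s 1 = 0) ∨ s 0 = 0) ∧
    (∀ s ∈ Q.support, s 0 = 0 ∧ s 1 = 1) ∧
    (∃ s ∈ P.support, s 0 = 1 ∧ s 1 = 0) ∧ (∃ s ∈ Q.support, s 0 = 0 ∧ s 1 = 1) := by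
  classical
  have key : ∀ n, coeff n (X 0 * X 1 * C c) = ∑ st ∈ Finset.HasAntidiagonal.antidiagonal n,
      coeff st.1 P * coeff st.2 Q * ((st.1 0 : K) * st.2 1 - st.1 1 * st.2 0) := by
    intro n; rw [← jac_coeff, hJ]
  have hB : ∀ v ∈ Q.support, 1 ≤ v 1 := by
    intro v hv
    by_contra hh
    exact (mem_support_iff.1 hv) (hQ v (by omega))
  have hex : ∃ u ∈ P.support, ∃ v ∈ Q.support, (u 0 = 1 ∧ u 1 = 0) ∧ (v 0 = 0 ∧ v 1 = 1) := by
    have h1 := key (Finsupp.single 0 1 + Finsupp.single 1 1)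
    have h2 : coeff (Finsupp.single 0 1 + Finsupp.single 1 1)
        (X 0 * X 1 * C c : MvPolynomial (Fin 2) K) = c := by
      rw [X, X, C_apply, monomial_mul, monomial_mul]; simp
    rw [h2] at h1
    rw [h1] at hc
    obtain ⟨⟨u, v⟩, huv, hne⟩ := Finset.exists_ne_zero_of_sum_ne_zero hc
    rw [Finset.HasAntidiagonal.mem_antidiagonal] at huv
    simp only at huv hne
    have hu : u ∈ P.support := by
      rw [mem_support_iff]; intro h; simp [h] at hne
    have hv : v ∈ Q.support := by
      rw [mem_support_iff]; intro h; simp [h] at hne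
    have e0 : u 0 + v 0 = 1 := by
      have := DFunLike.congr_fun huv 0
      simpa using this
    have e1 : u 1 + v 1 = 1 := by
      have := DFunLike.congr_fun huv 1
      simpa using this
    have := hB v hv
    have hu0 : u 0 ≠ 0 := by
      intro h
      have : u = 0 := fin2_ext (by simpa using h) (by simp; omega)
      rw [this, mem_support_iff] at hu
      exact hu hP0
    exact ⟨u, hu, v, hv, by omega, by omega⟩
  obtain ⟨e, he, e', he', ⟨h1, h2⟩, h3, h4⟩ := hex
  have := comb_core P.support Q.support (fun s => (s 0 : ℤ)) (fun s => (s 1 : ℤ))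
    (fun _ => by positivity) (fun _ => by positivity) (by
      intro u hu v hv huniq
      by_contra hh
      push Not at hh
      have k := key (u + v)
      rw [Finset.sum_eq_single (u, v)] at k
      · have hne : coeff (u + v) (X 0 * X 1 * C c) ≠ 0 := by
          rw [k]
          refine mul_ne_zero (mul_ne_zero (mem_support_iff.1 hu) (mem_support_iff.1 hv)) ?_
          rw [sub_ne_zero]
          intro h
          apply hh.2
          exact_mod_cast h
        have := xy_coeff c _ hne
        simp only [Finsupp.add_apply] at this
        exact hh.1 (by exact_mod_cast this.1) (by exact_mod_cast this.2)
      · rintro ⟨u', v'⟩ hm hne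
        rw [Finset.HasAntidiagonal.mem_antidiagonal] at hm
        simp only at hm ⊢
        by_contra hnz
        have hu' : u' ∈ P.support := by
          rw [mem_support_iff]; intro h; simp [h] at hnz
        have hv' : v' ∈ Q.support := by
          rw [mem_support_iff]; intro h; simp [h] at hnz
        have e0 := DFunLike.congr_fun hm 0
        have e1 := DFunLike.congr_fun hm 1
        simp only [Finsupp.add_apply] at e0 e1
        have := huniq u' hu' v' hv' (by exact_mod_cast e0) (by exact_mod_cast e1)
        have hueq : u' = u := fin2_ext (by omega) (by omega)
        subst hueq
        exact hne (by rw [add_left_cancel hm])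
      · intro h; simp at h)
    (fun v hv => by exact_mod_cast hB v hv) e he (by simp [h1]) (by simp [h2])
    e' he' (by simp [h3]) (by simp [h4])
  exact ⟨fun s hs => by have := this.1 s hs; omega, fun s hs => by have := this.2 s hs; omega,
    ⟨e, he, h1, h2⟩, ⟨e', he', h3, h4⟩⟩

theorem surj_inj (F : MvPolynomial (Fin 2) K →ₐ[K] MvPolynomial (Fin 2) K)
    (hF : Function.Surjective F) : Function.Injective F := by
  have hmono : ∀ n : ℕ, RingHom.ker (F ^ n) ≤ RingHom.ker (F ^ (n + 1)) := by
    intro n z hz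
    rw [RingHom.mem_ker] at hz ⊢
    rw [pow_succ', AlgHom.mul_apply, hz, map_zero]
  obtain ⟨n, hn⟩ := monotone_stabilizes_iff_noetherian.2
    (inferInstanceAs (IsNoetherianRing (MvPolynomial (Fin 2) K)))
    ⟨fun n => RingHom.ker (F ^ n), monotone_nat_of_le_succ hmono⟩
  have hs : ∀ k : ℕ, Function.Surjective (F ^ k : MvPolynomial (Fin 2) K →ₐ[K] _) := by
    intro k
    induction k with
    | zero => exact fun z => ⟨z, rfl⟩
    | succ k ih =>
      intro z
      obtain ⟨y, rfl⟩ := hF z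
      obtain ⟨x, rfl⟩ := ih y
      exact ⟨x, by rw [pow_succ', AlgHom.mul_apply]⟩
  rw [injective_iff_map_eq_zero]
  intro z hz
  obtain ⟨w, rfl⟩ := hs n z
  have h1 : w ∈ RingHom.ker (F ^ (n + 1)) := by
    rw [RingHom.mem_ker, pow_succ', AlgHom.mul_apply, hz]
  have h2 : RingHom.ker (F ^ n) = RingHom.ker (F ^ (n + 1)) := hn (n + 1) (Nat.le_succ n)
  rw [← h2, RingHom.mem_ker] at h1
  exact h1

theorem supp_mem (S : Subalgebra K (MvPolynomial (Fin 2) K)) (P : MvPolynomial (Fin 2) K)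
    (h1 : X 1 ∈ S) (h : ∀ s ∈ P.support, s 0 = 0) : P ∈ S := by
  rw [P.as_sum]
  refine S.sum_mem fun s hs => ?_
  rw [monomial_eq, Finsupp.prod_fintype _ _ (by simp), Fin.prod_univ_two, h s hs]
  simp only [pow_zero, one_mul]
  exact S.mul_mem (S.algebraMap_mem _) (S.pow_mem h1 _)

theorem normal_bij [CharZero K] (F : MvPolynomial (Fin 2) K →ₐ[K] MvPolynomial (Fin 2) K)
    (c : K) (hc : c ≠ 0) (hJ : Jac (F (X 0)) (F (X 1)) = C c)
    (hQ : ∀ s : Fin 2 →₀ ℕ, s 1 = 0 → coeff s (F (X 1)) = 0) : Function.Bijective F := by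
  classical
  set P := F (X 0) - C (coeff 0 (F (X 0))) with hP
  set Q := F (X 1) with hQd
  have hJ' : Jac P Q = C c := by rw [← hJ]; simp [Jac, hP]
  obtain ⟨t1, t2, ⟨s, hs, hs0, hs1⟩, ⟨s', hs', hs0', hs1'⟩⟩ :=
    triangular P Q c hc hJ' (by simp [hP]) hQ
  have hCr : ∀ a : K, C a ∈ F.range := fun a => F.range.algebraMap_mem a
  have hPr : P ∈ F.range := F.range.sub_mem ⟨X 0, rfl⟩ (hCr _)
  have hQr : Q ∈ F.range := ⟨X 1, rfl⟩
  have se' : s' = Finsupp.single 1 1 := fin2_ext (by simp [hs0']) (by simp [hs1'])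
  have se : s = Finsupp.single 0 1 := fin2_ext (by simp [hs0]) (by simp [hs1])
  have hQe : Q = C (coeff s' Q) * X 1 := by
    ext t
    rw [coeff_C_mul, coeff_X, ← se']
    split_ifs with h
    · subst h; simp
    · by_contra hh
      have := t2 t (mem_support_iff.2 (by simpa using hh))
      exact h (fin2_ext (by omega) (by omega))
  have hX1 : X 1 ∈ F.range := by
    have : (X 1 : MvPolynomial (Fin 2) K) = C ((coeff s' Q)⁻¹) * Q := by
      have hk := mem_support_iff.1 hs'
      generalize coeff s' Q = k at hQe hk
      rw [hQe, ← mul_assoc, ← C_mul, inv_mul_cancel₀ hk]; simp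
    rw [this]; exact F.range.mul_mem (hCr _) hQr
  have hR : P - C (coeff s P) * X 0 ∈ F.range := by
    apply supp_mem _ _ hX1
    intro t ht
    rw [mem_support_iff, coeff_sub, coeff_C_mul, coeff_X, ← se] at ht
    by_contra h0
    split_ifs at ht with h
    · subst h; simp at ht
    · have := t1 t (mem_support_iff.2 (by simpa using ht))
      exact h (fin2_ext (by omega) (by omega))
  have hX0 : X 0 ∈ F.range := by
    have : (X 0 : MvPolynomial (Fin 2) K) =
        C ((coeff s P)⁻¹) * (P - (P - C (coeff s P) * X 0)) := by
      rw [sub_sub_cancel, ← mul_assoc, ← C_mul, inv_mul_cancel₀ (mem_support_iff.1 hs)]; simp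
    rw [this]; exact F.range.mul_mem (hCr _) (F.range.sub_mem hPr hR)
  have hsurj : Function.Surjective F := by
    rw [← AlgHom.range_eq_top, ← top_le_iff, ← MvPolynomial.adjoin_range_X, Algebra.adjoin_le_iff]
    rintro _ ⟨i, rfl⟩
    fin_cases i
    · exact hX0
    · exact hX1
  exact ⟨surj_inj F hsurj, hsurj⟩

theorem pderiv_hom (φ : MvPolynomial (Fin 2) K →ₐ[K] MvPolynomial (Fin 2) K) (i : Fin 2)
    (A : MvPolynomial (Fin 2) K) : pderiv i (φ A) =
      φ (pderiv 0 A) * pderiv i (φ (X 0)) + φ (pderiv 1 A) * pderiv i (φ (X 1)) := by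
  induction A using MvPolynomial.induction_on with
  | C a =>
    have : φ (C a) = C a := φ.commutes a
    simp [this]
  | add p q hp hq => simp only [map_add, hp, hq]; ring
  | mul_X p j hp =>
    simp only [map_mul, pderiv_mul, hp, map_add]
    fin_cases j <;> simp [pderiv_X] <;> ring

theorem jac_hom (φ : MvPolynomial (Fin 2) K →ₐ[K] MvPolynomial (Fin 2) K)
    (A B : MvPolynomial (Fin 2) K) :
    Jac (φ A) (φ B) = φ (Jac A B) * Jac (φ (X 0)) (φ (X 1)) := by
  unfold Jac
  rw [pderiv_hom φ 0 A, pderiv_hom φ 1 A, pderiv_hom φ 0 B, pderiv_hom φ 1 B]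
  simp only [map_sub, map_mul]; ring

theorem jac_equiv (φ : MvPolynomial (Fin 2) K ≃ₐ[K] MvPolynomial (Fin 2) K) :
    ∃ c : K, c ≠ 0 ∧ Jac (φ (X 0)) (φ (X 1)) = C c := by
  have h := jac_hom φ.toAlgHom (φ.symm (X 0)) (φ.symm (X 1))
  have h1 : Jac (X 0 : MvPolynomial (Fin 2) K) (X 1) = 1 := by simp [Jac, pderiv_X]
  change Jac (φ (φ.symm (X 0))) (φ (φ.symm (X 1))) = φ _ * Jac (φ (X 0)) (φ (X 1)) at h
  rw [AlgEquiv.apply_symm_apply, AlgEquiv.apply_symm_apply, h1] at h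
  have hu : IsUnit (Jac (φ (X 0)) (φ (X 1))) := IsUnit.of_mul_eq_one_right _ h.symm
  rw [MvPolynomial.isUnit_iff_eq_C_of_isReduced] at hu
  obtain ⟨r, hr, h2⟩ := hu
  exact ⟨r, hr.ne_zero, h2⟩

theorem jac_comp (φ ψ : MvPolynomial (Fin 2) K →ₐ[K] MvPolynomial (Fin 2) K)
    (hφ : ∃ c : K, c ≠ 0 ∧ Jac (φ (X 0)) (φ (X 1)) = C c)
    (hψ : ∃ c : K, c ≠ 0 ∧ Jac (ψ (X 0)) (ψ (X 1)) = C c) :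
    ∃ c : K, c ≠ 0 ∧ Jac (φ (ψ (X 0))) (φ (ψ (X 1))) = C c := by
  obtain ⟨c, hc, h1⟩ := hφ
  obtain ⟨d, hd, h2⟩ := hψ
  refine ⟨d * c, mul_ne_zero hd hc, ?_⟩
  have : φ (C d) = C d := φ.commutes d
  rw [jac_hom, h1, h2, this, C_mul]

/-- The linear change of coordinates `x ↦ x + y`, `y ↦ x - y`. -/
noncomputable def sig (K : Type*) [Field K] [CharZero K] :
    MvPolynomial (Fin 2) K ≃ₐ[K] MvPolynomial (Fin 2) K :=
  AlgEquiv.ofAlgHom (aeval ![X 0 + X 1, X 0 - X 1])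
    (aeval ![C (1/2) * (X 0 + X 1), C (1/2) * (X 0 - X 1)])
    (by
      have h : (C (1/2) * 2 : MvPolynomial (Fin 2) K) = 1 := by
        rw [show (2 : MvPolynomial (Fin 2) K) = C 2 from rfl, ← C_mul]; simp
      apply MvPolynomial.algHom_ext
      intro i
      fin_cases i
      · simp [algebraMap_eq] at h ⊢
        linear_combination X 0 * h
      · simp [algebraMap_eq] at h ⊢
        linear_combination X 1 * h)
    (by
      have h : (C (1/2) * 2 : MvPolynomial (Fin 2) K) = 1 := by
        rw [show (2 : MvPolynomial (Fin 2) K) = C 2 from rfl, ← C_mul]; simp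
      apply MvPolynomial.algHom_ext
      intro i
      fin_cases i
      · simp at h ⊢
        linear_combination X 0 * h
      · simp at h ⊢
        linear_combination X 1 * h)

theorem coeff_neg_y (P : MvPolynomial (Fin 2) K) (s : Fin 2 →₀ ℕ) :
    coeff s (aeval (![X 0, - X 1] : Fin 2 → MvPolynomial (Fin 2) K) P)
      = (-1) ^ (s 1) * coeff s P := by
  classical
  induction P using MvPolynomial.induction_on' with
  | monomial u c =>
    have : aeval (![X 0, - X 1] : Fin 2 → MvPolynomial (Fin 2) K) (monomial u c)
        = C ((-1) ^ (u 1)) * monomial u c := by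
      rw [aeval_monomial, monomial_eq, Finsupp.prod_fintype _ _ (by simp),
        Finsupp.prod_fintype _ _ (by simp), Fin.prod_univ_two, Fin.prod_univ_two, algebraMap_eq]
      simp only [Matrix.cons_val_zero, Matrix.cons_val_one, map_pow, map_neg, map_one]
      rw [neg_pow (X 1 : MvPolynomial (Fin 2) K)]
      ring
    rw [this, coeff_C_mul, coeff_monomial]
    split_ifs with h
    · subst h; rfl
    · simp
  | add p q hp hq => simp only [map_add, coeff_add, hp, hq, mul_add]

theorem sig_conj [CharZero K] (p : MvPolynomial (Fin 2) K) :
    exch K (sig K p) = sig K (aeval (![X 0, - X 1] : Fin 2 → MvPolynomial (Fin 2) K) p) := by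
  have : ((exch K).toAlgHom.comp (sig K).toAlgHom) =
      (sig K).toAlgHom.comp (aeval (![X 0, - X 1] : Fin 2 → MvPolynomial (Fin 2) K)) := by
    apply MvPolynomial.algHom_ext
    intro i
    fin_cases i
    · simp [exch, sig, add_comm]
    · simp [exch, sig]
  exact DFunLike.congr_fun this p

theorem exch_bij [CharZero K] (F : MvPolynomial (Fin 2) K →ₐ[K] MvPolynomial (Fin 2) K)
    (hJ : ∃ c : K, c ≠ 0 ∧ Jac (F (X 0)) (F (X 1)) = C c)
    (hF : ∀ p, F (exch K p) = exch K (F p)) : Function.Bijective F := by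
  set F' : MvPolynomial (Fin 2) K →ₐ[K] MvPolynomial (Fin 2) K :=
    (sig K).symm.toAlgHom.comp (F.comp (sig K).toAlgHom) with hF'
  have happ : ∀ p, F' p = (sig K).symm (F (sig K p)) := fun p => rfl
  obtain ⟨c, hc, hJ'⟩ : ∃ c : K, c ≠ 0 ∧ Jac (F' (X 0)) (F' (X 1)) = C c :=
    jac_comp (sig K).symm.toAlgHom (F.comp (sig K).toAlgHom) (jac_equiv (sig K).symm)
      (jac_comp F (sig K).toAlgHom hJ (jac_equiv (sig K)))
  have hbij : Function.Bijective F' := by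
    refine normal_bij F' c hc hJ' ?_
    intro s hs
    have h1 : aeval (![X 0, - X 1] : Fin 2 → MvPolynomial (Fin 2) K) (F' (X 1)) = - F' (X 1) := by
      apply (sig K).injective
      rw [← sig_conj, map_neg, happ, AlgEquiv.apply_symm_apply, ← hF, sig_conj]
      simp
    have h2 := coeff_neg_y (F' (X 1)) s
    rw [h1, hs, coeff_neg] at h2
    simp only [pow_zero, one_mul] at h2
    exact self_eq_neg.1 h2.symm
  have : (F : MvPolynomial (Fin 2) K → MvPolynomial (Fin 2) K) =
      (sig K) ∘ F' ∘ (sig K).symm := by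
    funext p; simp [happ]
  rw [this]
  exact (sig K).bijective.comp (hbij.comp (sig K).symm.bijective)

end helpers

/-- The Jacobian conjecture is equivalent to the `g,h` conjecture. -/
theorem stmt3 {K : Type*} [Field K] [CharZero K] :
    (∀ f : MvPolynomial (Fin 2) K →ₐ[K] MvPolynomial (Fin 2) K,
        (∃ c : K, c ≠ 0 ∧ Jac (f (X 0)) (f (X 1)) = C c) →
        Function.Bijective f) ↔
    (∀ f : MvPolynomial (Fin 2) K →ₐ[K] MvPolynomial (Fin 2) K,
        (∃ c : K, c ≠ 0 ∧ Jac (f (X 0)) (f (X 1)) = C c) →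
        ∃ g h : MvPolynomial (Fin 2) K ≃ₐ[K] MvPolynomial (Fin 2) K,
          ∀ p, h (f (g.symm (exch K p))) = exch K (h (f (g.symm p)))) := by
  constructor
  · intro H f hf
    refine ⟨AlgEquiv.ofBijective f (H f hf), AlgEquiv.refl, fun p => ?_⟩
    have : ∀ q, f ((AlgEquiv.ofBijective f (H f hf)).symm q) = q := fun q =>
      (AlgEquiv.ofBijective f (H f hf)).apply_symm_apply q
    simp [this]
  · intro H f hf
    obtain ⟨g, h, hgh⟩ := H f hf
    have hb := exch_bij (h.toAlgHom.comp (f.comp g.symm.toAlgHom))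
      (jac_comp h.toAlgHom (f.comp g.symm.toAlgHom) (jac_equiv h)
        (jac_comp f g.symm.toAlgHom hf (jac_equiv g.symm))) hgh
    have : (f : MvPolynomial (Fin 2) K → MvPolynomial (Fin 2) K) =
        h.symm ∘ (h.toAlgHom.comp (f.comp g.symm.toAlgHom)) ∘ g := by
      funext p; simp
    rw [this]
    exact h.symm.bijective.comp (hb.comp g.bijective)
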